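/- There is an integer E₂ depending only on n and k (the paper computes E₂ = 2k²·ℓ₁ + k²·E₁) such that for every xy ∈ {αβ, αγ, βγ} and every pair of k-cliques t₁, t₂ ∈ C_k: the weighted RNA folding score WRNA([CNG(t₁) ∘ p(CLG(t₂))^R]_{xy}) equals E₂ if t₁ ∪ t₂ forms a 2k-clique in G, and is at most E₂ − 1 otherwise. -/

import Mathlib

/-!
Formalization of (weighted) RNA folding from
"If the Current Clique Algorithms are Optimal, so is Valiant's Parser"
(Abboud, Backurs, Vassilevska Williams), Section 3.

Letters come from `Σ ∪ Σ'`, modelled as `σ ⊕ σ`: `Sum.inl a` is the letter `a ∈ Σ` and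
`Sum.inr a` is its matching letter `a' ∈ Σ'`.
-/

namespace RNAFolding

/-- Letters `x` and `y` match iff `y = x'` or `x = y'`. -/
def LMatches {σ : Type*} : σ ⊕ σ → σ ⊕ σ → Prop
  | .inl a, .inr b => a = b
  | .inr a, .inl b => a = b
  | _, _ => False

/-- Two pairs of indices `(i₁,j₁)`, `(i₂,j₂)` with `i₁<j₁` and `i₂<j₂` "cross" iff they share an
index, or `i₁<i₂<j₁<j₂`, or `i₂<i₁<j₂<j₁`. -/
def Crosses (p q : ℕ × ℕ) : Prop :=
  p.1 = q.1 ∨ p.1 = q.2 ∨ p.2 = q.1 ∨ p.2 = q.2 ∨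
    (p.1 < q.1 ∧ q.1 < p.2 ∧ p.2 < q.2) ∨ (q.1 < p.1 ∧ p.1 < q.2 ∧ q.2 < p.2)

/-- `A` is a valid folding of `S`: every pair `(i,j) ∈ A` satisfies `i < j < |S|` and the letters
`S[i]`, `S[j]` match, and no two pairs of `A` cross. -/
def IsFolding {σ : Type*} (S : List (σ ⊕ σ)) (A : Finset (ℕ × ℕ)) : Prop :=
  (∀ p ∈ A, p.1 < p.2 ∧ p.2 < S.length ∧ ∃ x ∈ S[p.1]?, ∃ y ∈ S[p.2]?, LMatches x y) ∧
    ∀ p ∈ A, ∀ q ∈ A, p ≠ q → ¬ Crosses p q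

/-- The weighted RNA folding score `WRNA(S)`: the maximum of `∑_{(i,j) ∈ A} w(S[i])` over all
valid foldings `A` of `S` (with the weight function extended to `Σ'` by `w(σ') = w(σ)`). -/
noncomputable def WRNA {σ : Type*} (w : σ → ℕ) (S : List (σ ⊕ σ)) : ℕ :=
  sSup {m | ∃ A : Finset (ℕ × ℕ),
    IsFolding S A ∧ ∑ p ∈ A, (S.map (Sum.elim w w)).getD p.1 0 = m}

/-- The (unweighted) RNA folding score `RNA(S)`: the maximum number of non-crossing matching
pairs, i.e. the weighted score with all weights equal to `1`. -/
noncomputable def RNA {σ : Type*} (S : List (σ ⊕ σ)) : ℕ := WRNA (fun _ => 1) S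

/-! ### The clique-detecting RNA sequence -/

/-- The three pairs of types `αβ`, `αγ`, `βγ`. -/
inductive PT
  | ab | ag | bg
  deriving DecidableEq

/-- The base symbols `0, 1, $, #, g` that get marked with a pair of types. -/
inductive RBase
  | b0 | b1 | dollar | hash | g
  deriving DecidableEq

/-- The 18 plain letters: `Σ = {α, β, γ} ∪ ⋃_{xy ∈ {αβ,αγ,βγ}} {0, 1, $, #, g}_xy`
(together with the matching copies `Σ'` this makes 36 letters). -/
inductive RSig
  | alpha | beta | gamma
  | mk (b : RBase) (p : PT)
  deriving DecidableEq

/-- Letters: a plain (`Sum.inl`) or primed (`Sum.inr`) copy of each symbol of `Σ`. -/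
abbrev RL := RSig ⊕ RSig

/-- A "core" symbol: a base symbol with a primed-ness flag, before marking by a pair of types. -/
abbrev RCore := Bool × RBase

/-- Marking a core symbol with the pair of types `xy`. -/
def mark (p : PT) : RCore → RL
  | (false, b) => .inl (.mk b p)
  | (true, b) => .inr (.mk b p)

/-- `[s]_xy`: marking every letter of a core string with the pair of types `xy`. -/
def markStr (p : PT) (s : List RCore) : List RL := s.map (mark p)

/-- `p(s)`: replacing every letter `σ` by its matching letter `σ'` (and conversely). -/
def primeStr (s : List RCore) : List RCore := s.map (fun x => (!x.1, x.2))

/-- `m`-fold repetition `l^m` of a list. -/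
def rep {α : Type*} (l : List α) (m : ℕ) : List α := (List.replicate m l).flatten

/-- The binary encoding `v̄` of a node `v`, of length exactly `2⌈log n⌉`, as a core string. -/
def bin (n : ℕ) (v : Fin n) : List RCore :=
  (List.range (2 * Nat.clog 2 n)).map
    (fun i => (false, if v.val.testBit i then RBase.b1 else RBase.b0))

/-- The (unprimed) letter `$`. -/
def dol : RCore := (false, .dollar)

/-- The (unprimed) letter `#`. -/
def hsh : RCore := (false, .hash)

open Classical in
/-- The neighbors of `v`, in some fixed order. -/
noncomputable def nbrs (n : ℕ) (G : SimpleGraph (Fin n)) (v : Fin n) : List (Fin n) :=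
  (Finset.univ.filter (fun u => G.Adj v u)).toList

open Classical in
/-- The non-neighbors of `v`, in some fixed order. -/
noncomputable def nonNbrs (n : ℕ) (G : SimpleGraph (Fin n)) (v : Fin n) : List (Fin n) :=
  (Finset.univ.filter (fun u => ¬ G.Adj v u)).toList

/-- The node gadget `NG(v) = $^{2n} v̄ $^{2n}`. -/
def NGr (n : ℕ) (v : Fin n) : List RCore :=
  List.replicate (2 * n) dol ++ bin n v ++ List.replicate (2 * n) dol

/-- The list gadget `LG(v) = (∘_{u ∈ N(v)} ($ ū $)) ∘ (∘_{u ∉ N(v)} ($ $))`. -/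
noncomputable def LGr (n : ℕ) (G : SimpleGraph (Fin n)) (v : Fin n) : List RCore :=
  (nbrs n G v).flatMap (fun u => [dol] ++ bin n u ++ [dol]) ++
    (nonNbrs n G v).flatMap (fun _ => [dol, dol])

/-- The clique node gadget `CNG(t) = ∘_{v ∈ t} (# NG(v) #)^k`. -/
noncomputable def CNGr (n k : ℕ) (t : Finset (Fin n)) : List RCore :=
  t.toList.flatMap (fun v => rep ([hsh] ++ NGr n v ++ [hsh]) k)

/-- The clique list gadget `CLG(t) = (∘_{v ∈ t} (# LG(v) #))^k`. -/
noncomputable def CLGr (n k : ℕ) (G : SimpleGraph (Fin n)) (t : Finset (Fin n)) : List RCore :=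
  rep (t.toList.flatMap (fun v => [hsh] ++ LGr n G v ++ [hsh])) k

/-- `CG_α(t) = [g CNG(t) g]_{αγ} ∘ [g' p(CLG(t))^R g']_{αβ}`. -/
noncomputable def CGa (n k : ℕ) (G : SimpleGraph (Fin n)) (t : Finset (Fin n)) : List RL :=
  markStr .ag ([(false, .g)] ++ CNGr n k t ++ [(false, .g)]) ++
    markStr .ab ([(true, .g)] ++ (primeStr (CLGr n k G t)).reverse ++ [(true, .g)])

/-- `CG_β(t) = [g CNG(t) g]_{αβ} ∘ [g' p(CLG(t))^R g']_{βγ}`. -/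
noncomputable def CGb (n k : ℕ) (G : SimpleGraph (Fin n)) (t : Finset (Fin n)) : List RL :=
  markStr .ab ([(false, .g)] ++ CNGr n k t ++ [(false, .g)]) ++
    markStr .bg ([(true, .g)] ++ (primeStr (CLGr n k G t)).reverse ++ [(true, .g)])

/-- `CG_γ(t) = [g CNG(t) g]_{βγ} ∘ [g' p(CLG(t))^R g']_{αγ}`. -/
noncomputable def CGg (n k : ℕ) (G : SimpleGraph (Fin n)) (t : Finset (Fin n)) : List RL :=
  markStr .bg ([(false, .g)] ++ CNGr n k t ++ [(false, .g)]) ++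
    markStr .ag ([(true, .g)] ++ (primeStr (CLGr n k G t)).reverse ++ [(true, .g)])

/-- `log n` (base 2). -/
def logn (n : ℕ) : ℕ := Nat.log 2 n

/-- `ℓ₁ = 10·k²·n·log n`. -/
def l1 (n k : ℕ) : ℕ := 10 * k ^ 2 * n * logn n

/-- `ℓ₂ = 10·k²·ℓ₁`. -/
def l2 (n k : ℕ) : ℕ := 10 * k ^ 2 * l1 n k

/-- `ℓ₃ = 10·ℓ₂`. -/
def l3 (n k : ℕ) : ℕ := 10 * l2 n k

/-- The weight function: `w(0) = w(1) = 1`, `w($) = 10·log n`, `w(#) = ℓ₁`, `w(g) = ℓ₂`,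
`w(α) = w(β) = w(γ) = ℓ₃`. -/
def wt (n k : ℕ) : RSig → ℕ
  | .alpha => l3 n k
  | .beta => l3 n k
  | .gamma => l3 n k
  | .mk .b0 _ => 1
  | .mk .b1 _ => 1
  | .mk .dollar _ => 10 * logn n
  | .mk .hash _ => l1 n k
  | .mk .g _ => l2 n k

open Classical in
/-- The set `C_k` of `k`-cliques of `G`, in some fixed order. -/
noncomputable def cliqueList (n k : ℕ) (G : SimpleGraph (Fin n)) : List (Finset (Fin n)) :=
  (Finset.univ.filter (fun t => G.IsNClique k t)).toList

/-- The clique-detecting sequence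
`S_G = α^{2n^k} (∘_t α' CG_α(t) α') α^{2n^k} ∘ β^{2n^k} (∘_t β' CG_β(t) β') β^{2n^k} ∘
γ^{2n^k} (∘_t γ' CG_γ(t) γ') γ^{2n^k}`. -/
noncomputable def SG (n k : ℕ) (G : SimpleGraph (Fin n)) : List RL :=
  List.replicate (2 * n ^ k) (.inl .alpha) ++
    (cliqueList n k G).flatMap (fun t => [.inr .alpha] ++ CGa n k G t ++ [.inr .alpha]) ++
    List.replicate (2 * n ^ k) (.inl .alpha) ++
  (List.replicate (2 * n ^ k) (.inl .beta) ++
    (cliqueList n k G).flatMap (fun t => [.inr .beta] ++ CGb n k G t ++ [.inr .beta]) ++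
    List.replicate (2 * n ^ k) (.inl .beta)) ++
  (List.replicate (2 * n ^ k) (.inl .gamma) ++
    (cliqueList n k G).flatMap (fun t => [.inr .gamma] ++ CGg n k G t ++ [.inr .gamma]) ++
    List.replicate (2 * n ^ k) (.inl .gamma))

/-! ### Generic part: foldings and common subsequences -/

lemma core_sublist {ι τ : Type*} [DecidableEq ι] (w : τ → ℕ) (f g : ι → ℕ) (c : ι → τ)
    (A : Finset ι) : ∀ (X Y : List τ),
    (∀ p ∈ A, X[f p]? = some (c p) ∧ Y[g p]? = some (c p)) →
    (∀ p ∈ A, ∀ q ∈ A, p ≠ q → (f p < f q ∧ g p < g q) ∨ (f q < f p ∧ g q < g p)) →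
    ∃ Z : List τ, Z.Sublist X ∧ Z.Sublist Y ∧ (Z.map w).sum = ∑ p ∈ A, w (c p) := by
  induction A using Finset.induction_on_max_value f with
  | empty => intro X Y _ _; exact ⟨[], by simp, by simp, by simp⟩
  | insert a s has hmax ih =>
    intro X Y h1 h2
    have hlt : ∀ p ∈ s, f p < f a ∧ g p < g a := by
      intro p hp
      have hne : p ≠ a := fun h => has (h ▸ hp)
      have := h2 p (Finset.mem_insert_of_mem hp) a (Finset.mem_insert_self _ _) hne
      have := hmax p hp
      omega
    obtain ⟨Z, hX, hY, hs⟩ := ih (X.take (f a)) (Y.take (g a)) (by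
      intro p hp
      have := h1 p (Finset.mem_insert_of_mem hp)
      rw [List.getElem?_take_of_lt (hlt p hp).1, List.getElem?_take_of_lt (hlt p hp).2]
      exact this) (fun p hp q hq => h2 p (Finset.mem_insert_of_mem hp) q
        (Finset.mem_insert_of_mem hq))
    obtain ⟨ha1, ha2⟩ := h1 a (Finset.mem_insert_self _ _)
    have key : ∀ (X : List τ) (i : ℕ) (x : τ), X[i]? = some x → Z.Sublist (X.take i) →
        (Z ++ [x]).Sublist X := by
      intro X i x hx hZ
      have h3 : X.take (i+1) = X.take i ++ [x] := by
        rw [List.take_add_one, hx]; rfl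
      have : (Z ++ [x]).Sublist (X.take (i+1)) := by
        rw [h3]; exact List.Sublist.append hZ (List.Sublist.refl _)
      exact this.trans (List.take_sublist _ _)
    refine ⟨Z ++ [c a], key X _ _ ha1 hX, key Y _ _ ha2 hY, ?_⟩
    rw [Finset.sum_insert has, ← hs]
    simp [add_comm]

/-- The string of a pair of plain strings. -/
def dbl {τ σ : Type*} (φ : τ → σ) (X Y : List τ) : List (σ ⊕ σ) :=
  X.map (fun x => Sum.inl (φ x)) ++ (Y.map (fun x => Sum.inr (φ x))).reverse

lemma dbl_length {τ σ : Type*} (φ : τ → σ) (X Y : List τ) :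
    (dbl φ X Y).length = X.length + Y.length := by simp [dbl]

lemma dbl_left {τ σ : Type*} (φ : τ → σ) (X Y : List τ) (i : ℕ) (h : i < X.length) :
    (dbl φ X Y)[i]? = some (Sum.inl (φ X[i])) := by
  simp [dbl, List.getElem?_append_left, h]

lemma dbl_right {τ σ : Type*} (φ : τ → σ) (X Y : List τ) (i : ℕ) (h : X.length ≤ i)
    (h2 : i < X.length + Y.length) :
    (dbl φ X Y)[i]? = some (Sum.inr (φ (Y[X.length + Y.length - 1 - i]'(by omega)))) := by
  have : i - X.length < Y.length := by omega
  unfold dbl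
  rw [List.getElem?_append_right (by simpa using h), List.getElem?_reverse (by simpa using this)]
  simp only [List.length_map, List.getElem?_map]
  have e : Y.length - 1 - (i - X.length) = X.length + Y.length - 1 - i := by omega
  rw [e, List.getElem?_eq_getElem (by omega)]
  rfl

lemma fold_to_sub {τ σ : Type*} (φ : τ → σ) (hφ : Function.Injective φ) (w : σ → ℕ)
    (X Y : List τ) (A : Finset (ℕ × ℕ)) (hA : IsFolding (dbl φ X Y) A) :
    ∃ Z : List τ, Z.Sublist X ∧ Z.Sublist Y ∧ (Z.map (fun x => w (φ x))).sum =
      ∑ p ∈ A, ((dbl φ X Y).map (Sum.elim w w)).getD p.1 0 := by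
  classical
  obtain ⟨h1, h2⟩ := hA
  have key : ∀ p ∈ A, ∃ c : τ, p.1 < X.length ∧ X.length ≤ p.2 ∧ p.2 < X.length + Y.length ∧
      X[p.1]? = some c ∧ Y[X.length + Y.length - 1 - p.2]? = some c ∧
      ((dbl φ X Y).map (Sum.elim w w)).getD p.1 0 = w (φ c) := by
    intro p hp
    obtain ⟨hlt, hlen, x, hx, y, hy, hm⟩ := h1 p hp
    rw [dbl_length] at hlen
    rw [Option.mem_def] at hx hy
    by_cases hp1 : p.1 < X.length
    · have hx' := hx
      rw [dbl_left φ X Y _ hp1] at hx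
      by_cases hp2 : p.2 < X.length
      · rw [dbl_left φ X Y _ hp2] at hy
        simp only [Option.some.injEq] at hx hy
        subst hx hy
        exact hm.elim
      · rw [dbl_right φ X Y _ (by omega) hlen] at hy
        simp only [Option.some.injEq] at hx hy
        subst hx hy
        have hm' := hφ hm
        refine ⟨X[p.1], hp1, by omega, hlen, List.getElem?_eq_getElem _, ?_, ?_⟩
        · rw [hm']; exact List.getElem?_eq_getElem _
        · rw [List.getD_eq_getElem?_getD, List.getElem?_map, hx']; rfl
    · rw [dbl_right φ X Y _ (by omega) (by omega)] at hx
      rw [dbl_right φ X Y _ (by omega) hlen] at hy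
      simp only [Option.some.injEq] at hx hy
      subst hx hy
      exact hm.elim
  by_cases hne : Nonempty τ
  swap
  · have : A = ∅ := by
      apply Finset.eq_empty_of_forall_notMem
      intro p hp
      exact hne ⟨(key p hp).choose⟩
    subst this
    exact ⟨[], by simp, by simp, by simp⟩
  choose! c hc using key
  obtain ⟨Z, hX, hY, hs⟩ := core_sublist (fun x => w (φ x)) (fun p : ℕ × ℕ => p.1)
    (fun p => X.length + Y.length - 1 - p.2) c A X Y
    (fun p hp => ⟨(hc p hp).2.2.2.1, (hc p hp).2.2.2.2.1⟩) (by
      intro p hp q hq hpq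
      have hcr := h2 p hp q hq hpq
      have a1 := hc p hp
      have a2 := hc q hq
      unfold Crosses at hcr
      obtain ⟨b1, b2, b3, -⟩ := a1
      obtain ⟨d1, d2, d3, -⟩ := a2
      omega)
  refine ⟨Z, hX, hY, hs.trans (Finset.sum_congr rfl fun p hp => ((hc p hp).2.2.2.2.2).symm)⟩

lemma sub_to_fold {τ σ : Type*} (φ : τ → σ) (w : σ → ℕ)
    (X Y Z : List τ) (hX : Z.Sublist X) (hY : Z.Sublist Y) :
    ∃ A : Finset (ℕ × ℕ), IsFolding (dbl φ X Y) A ∧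
      ∑ p ∈ A, ((dbl φ X Y).map (Sum.elim w w)).getD p.1 0 =
        (Z.map (fun x => w (φ x))).sum := by
  classical
  obtain ⟨f, hf⟩ := List.sublist_iff_exists_fin_orderEmbedding_get_eq.1 hX
  obtain ⟨g, hg⟩ := List.sublist_iff_exists_fin_orderEmbedding_get_eq.1 hY
  set N := X.length + Y.length with hN
  let P : Fin Z.length → ℕ × ℕ := fun i => ((f i : ℕ), N - 1 - (g i : ℕ))
  have hinj : Function.Injective P := by
    intro i j hij
    have : (f i : ℕ) = f j := congrArg Prod.fst hij
    exact f.injective (Fin.ext this)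
  refine ⟨Finset.univ.image P, ⟨?_, ?_⟩, ?_⟩
  · intro p hp
    obtain ⟨i, -, rfl⟩ := Finset.mem_image.1 hp
    have b1 := (f i).2
    have b2 := (g i).2
    refine ⟨by simp only [P]; omega, by rw [dbl_length]; simp only [P]; omega, _,
      dbl_left φ X Y _ b1, _, dbl_right φ X Y _ (by simp only [P]; omega)
        (by simp only [P]; omega), ?_⟩
    have e : X.length + Y.length - 1 - (P i).2 = g i := by simp only [P]; omega
    have h1 := hf i
    have h2 := hg i
    simp only [List.get_eq_getElem] at h1 h2
    simp only [LMatches, e, ← h1, ← h2]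
  · intro p hp q hq hpq
    obtain ⟨i, -, rfl⟩ := Finset.mem_image.1 hp
    obtain ⟨j, -, rfl⟩ := Finset.mem_image.1 hq
    have hij : i ≠ j := fun h => hpq (by rw [h])
    have b1 := (f i).2
    have b2 := (g i).2
    have b3 := (f j).2
    have b4 := (g j).2
    unfold Crosses
    simp only [P]
    rcases lt_or_gt_of_ne hij with h | h
    · have c1 : (f i : ℕ) < f j := f.strictMono h
      have c2 : (g i : ℕ) < g j := g.strictMono h
      omega
    · have c1 : (f j : ℕ) < f i := f.strictMono h
      have c2 : (g j : ℕ) < g i := g.strictMono h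
      omega
  · rw [Finset.sum_image (fun a _ b _ h => hinj h)]
    rw [← Fin.sum_univ_fun_getElem Z (fun x => w (φ x))]
    refine Finset.sum_congr rfl fun i _ => ?_
    have h1 := hf i
    simp only [List.get_eq_getElem] at h1
    rw [List.getD_eq_getElem?_getD, List.getElem?_map, dbl_left φ X Y _ (f i).2, h1]
    rfl

/-! ### List lemmas -/

lemma split_count {τ : Type*} [DecidableEq τ] (c : τ) (Z A B : List τ)
    (h : Z.Sublist (A ++ c :: B)) (hc : Z.count c = (A ++ c :: B).count c) :
    ∃ Z1 Z2, Z = Z1 ++ c :: Z2 ∧ Z1.Sublist A ∧ Z2.Sublist B := by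
  obtain ⟨Z1, Z', rfl, h1, h2⟩ := List.sublist_append_iff.1 h
  have a1 := h1.count_le c
  rcases List.sublist_cons_iff.1 h2 with h3 | ⟨Z2, rfl, h3⟩
  · have a2 := h3.count_le c
    simp at hc
    omega
  · exact ⟨Z1, Z2, rfl, h1, h3⟩

lemma split_unique {τ : Type*} (c : τ) : ∀ (Z1 Z2 Z1' Z2' : List τ),
    Z1 ++ c :: Z2 = Z1' ++ c :: Z2' → c ∉ Z1 → c ∉ Z1' → Z1 = Z1' ∧ Z2 = Z2' := by
  intro Z1
  induction Z1 with
  | nil =>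
    intro Z2 Z1' Z2' h _ h2
    cases Z1' with
    | nil => simpa using h
    | cons a t => simp at h h2; exact absurd h.1 h2.1
  | cons a t ih =>
    intro Z2 Z1' Z2' h h1 h2
    cases Z1' with
    | nil => simp at h h1; exact absurd h.1.symm h1.1
    | cons a' t' =>
      simp only [List.cons_append, List.cons.injEq, List.mem_cons, not_or] at h h1 h2
      obtain ⟨e1, e2⟩ := ih _ _ _ h.2 h1.2 h2.2
      exact ⟨by rw [h.1, e1], e2⟩

/-! ### The gadgets as plain strings -/

/-- Bit letters. -/
def isBit : RBase → Bool
  | .b0 => true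
  | .b1 => true
  | _ => false

/-- Plain version of `bin`. -/
def binb (n : ℕ) (v : Fin n) : List RBase :=
  (List.range (2 * Nat.clog 2 n)).map
    (fun i => if v.val.testBit i then RBase.b1 else RBase.b0)

/-- Plain version of `NGr`. -/
def NGb (n : ℕ) (v : Fin n) : List RBase :=
  List.replicate (2 * n) .dollar ++ binb n v ++ List.replicate (2 * n) .dollar

/-- Plain version of `LGr`. -/
noncomputable def LGb (n : ℕ) (G : SimpleGraph (Fin n)) (v : Fin n) : List RBase :=
  (nbrs n G v).flatMap (fun u => .dollar :: (binb n u ++ [.dollar])) ++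
    List.replicate (2 * (nonNbrs n G v).length) .dollar

/-- Embedding of plain letters. -/
def emb (b : RBase) : RCore := (false, b)

lemma bin_eq (n : ℕ) (v : Fin n) : bin n v = (binb n v).map emb := by
  simp [bin, binb, emb]

lemma NG_eq (n : ℕ) (v : Fin n) : NGr n v = (NGb n v).map emb := by
  simp [NGr, NGb, bin_eq, dol, emb]

lemma flatMap_two {α β : Type*} (l : List α) (d : β) :
    l.flatMap (fun _ => [d, d]) = List.replicate (2 * l.length) d := by
  induction l with
  | nil => simp
  | cons a t ih =>
    rw [List.flatMap_cons, ih, List.length_cons, show 2 * (t.length + 1) = 2 * t.length + 1 + 1 by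
      ring]
    simp [List.replicate_succ]

lemma LG_eq (n : ℕ) (G : SimpleGraph (Fin n)) (v : Fin n) :
    LGr n G v = (LGb n G v).map emb := by
  simp [LGr, LGb, bin_eq, dol, emb, flatMap_two, List.map_flatMap]

lemma rep_eq {α β : Type*} (l : List α) (s : List β) :
    rep l s.length = s.flatMap (fun _ => l) := by
  unfold rep
  induction s with
  | nil => simp
  | cons a t ih => simp [List.replicate_succ, ih]

/-- The list of pairs. -/
noncomputable def prs {n : ℕ} (t₁ t₂ : Finset (Fin n)) : List (Fin n × Fin n) :=
  t₁.toList.flatMap (fun v => t₂.toList.map (fun u => (v, u)))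

/-- Block of the first string. -/
def BX (n : ℕ) (p : Fin n × Fin n) : List RBase := .hash :: (NGb n p.1 ++ [.hash])

/-- Block of the second string. -/
noncomputable def BY (n : ℕ) (G : SimpleGraph (Fin n)) (p : Fin n × Fin n) : List RBase :=
  .hash :: (LGb n G p.2 ++ [.hash])

lemma CN_eq (n k : ℕ) (t₁ t₂ : Finset (Fin n)) (h2 : t₂.card = k) :
    CNGr n k t₁ = ((prs t₁ t₂).flatMap (BX n)).map emb := by
  have hr : ∀ l : List RCore, rep l k = t₂.toList.flatMap (fun _ => l) := by
    intro l
    rw [← rep_eq, Finset.length_toList, h2]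
  simp [CNGr, prs, hr, NG_eq, List.flatMap_assoc, List.map_flatMap, List.flatMap_map, BX, hsh,
    emb]

lemma CL_eq (n k : ℕ) (G : SimpleGraph (Fin n)) (t₁ t₂ : Finset (Fin n)) (h1 : t₁.card = k) :
    CLGr n k G t₂ = ((prs t₁ t₂).flatMap (BY n G)).map emb := by
  have hr : ∀ l : List RCore, rep l k = t₁.toList.flatMap (fun _ => l) := by
    intro l
    rw [← rep_eq, Finset.length_toList, h1]
  simp [CLGr, prs, hr, LG_eq, List.flatMap_assoc, List.map_flatMap, List.flatMap_map, BY, hsh,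
    emb]

lemma str_eq (n k : ℕ) (G : SimpleGraph (Fin n)) (xy : PT) (t₁ t₂ : Finset (Fin n))
    (h1 : t₁.card = k) (h2 : t₂.card = k) :
    markStr xy (CNGr n k t₁ ++ (primeStr (CLGr n k G t₂)).reverse) =
      dbl (fun b => RSig.mk b xy) ((prs t₁ t₂).flatMap (BX n)) ((prs t₁ t₂).flatMap (BY n G)) := by
  rw [CN_eq n k t₁ t₂ h2, CL_eq n k G t₁ t₂ h1]
  generalize (prs t₁ t₂).flatMap (BX n) = X
  generalize (prs t₁ t₂).flatMap (BY n G) = Y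
  simp only [markStr, primeStr, dbl, List.map_append, List.map_map, List.map_reverse]
  rfl

lemma prs_length {n : ℕ} (t₁ t₂ : Finset (Fin n)) :
    (prs t₁ t₂).length = t₁.card * t₂.card := by
  simp [prs, List.length_flatMap]

lemma mem_prs {n : ℕ} (t₁ t₂ : Finset (Fin n)) (p : Fin n × Fin n) :
    p ∈ prs t₁ t₂ ↔ p.1 ∈ t₁ ∧ p.2 ∈ t₂ := by
  obtain ⟨a, b⟩ := p
  simp [prs]

/-! ### Counting -/

lemma binb_length (n : ℕ) (v : Fin n) : (binb n v).length = 2 * Nat.clog 2 n := by simp [binb]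

lemma binb_bit (n : ℕ) (v : Fin n) : ∀ x ∈ binb n v, isBit x = true := by
  intro x hx
  simp only [binb, List.mem_map] at hx
  obtain ⟨i, -, rfl⟩ := hx
  split_ifs <;> rfl

lemma binb_inj (n : ℕ) (u v : Fin n) (h : binb n u = binb n v) : u = v := by
  apply Fin.ext
  apply Nat.eq_of_testBit_eq
  intro i
  by_cases hi : i < 2 * Nat.clog 2 n
  · have := congrArg (fun l => l[i]?) h
    simp only [binb, List.getElem?_map, List.getElem?_range hi, Option.map_some,
      Option.some.injEq] at this
    cases h1 : u.val.testBit i <;> cases h2 : v.val.testBit i <;> simp_all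
  · have hn : n ≤ 2 ^ i := (Nat.le_pow_clog one_lt_two n).trans
      (Nat.pow_le_pow_right (by norm_num) (by omega))
    rw [Nat.testBit_lt_two_pow (u.2.trans_le hn), Nat.testBit_lt_two_pow (v.2.trans_le hn)]

lemma binb_notMem (n : ℕ) (v : Fin n) (c : RBase) (hc : isBit c = false) : c ∉ binb n v := by
  intro h
  rw [binb_bit n v c h] at hc
  cases hc

lemma binb_count (n : ℕ) (v : Fin n) (c : RBase) (hc : isBit c = false) :
    (binb n v).count c = 0 := List.count_eq_zero.2 (binb_notMem n v c hc)

lemma binb_countP (n : ℕ) (v : Fin n) : (binb n v).countP isBit = 2 * Nat.clog 2 n := by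
  rw [List.countP_eq_length.2 (binb_bit n v), binb_length]

lemma nbrs_length (n : ℕ) (G : SimpleGraph (Fin n)) (v : Fin n) :
    (nbrs n G v).length + (nonNbrs n G v).length = n := by
  classical
  simp only [nbrs, nonNbrs, Finset.length_toList]
  rw [Finset.card_filter_add_card_filter_not]
  simp

lemma count_nb (n : ℕ) (us : List (Fin n)) (c : RBase) (hc : isBit c = false) :
    (us.flatMap (fun u => RBase.dollar :: (binb n u ++ [.dollar]))).count c =
      if c = .dollar then 2 * us.length else 0 := by
  induction us with
  | nil => simp
  | cons u t ih =>
    rw [List.flatMap_cons, List.count_append, ih]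
    simp only [List.count_cons, List.count_append, binb_count n u c hc, List.count_nil,
      List.length_cons]
    cases c <;> simp
    ring

lemma LGb_dollar (n : ℕ) (G : SimpleGraph (Fin n)) (v : Fin n) :
    (LGb n G v).count .dollar = 2 * n := by
  have := nbrs_length n G v
  rw [LGb, List.count_append, count_nb n _ _ rfl, List.count_replicate]
  simp
  omega

lemma LGb_hash (n : ℕ) (G : SimpleGraph (Fin n)) (v : Fin n) :
    (LGb n G v).count .hash = 0 := by
  rw [LGb, List.count_append, count_nb n _ _ rfl, List.count_replicate]
  simp

lemma NGb_count (n : ℕ) (v : Fin n) (c : RBase) (hc : isBit c = false) (hd : c ≠ .dollar) :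
    (NGb n v).count c = 0 := by
  rw [NGb, List.count_append, List.count_append, binb_count n v c hc, List.count_replicate]
  cases c <;> simp_all

lemma NGb_bits (n : ℕ) (v : Fin n) : (NGb n v).countP isBit = 2 * Nat.clog 2 n := by
  rw [NGb, List.countP_append, List.countP_append, binb_countP, List.countP_replicate]
  simp [isBit]

lemma X_hash (n : ℕ) (L : List (Fin n × Fin n)) :
    (L.flatMap (BX n)).count .hash = L.length * 2 := by
  induction L with
  | nil => simp
  | cons p t ih =>
    rw [List.flatMap_cons, List.count_append, ih]
    simp [BX, NGb_count n p.1 .hash rfl (by simp)]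
    ring

lemma X_g (n : ℕ) (L : List (Fin n × Fin n)) :
    (L.flatMap (BX n)).count .g = 0 := by
  induction L with
  | nil => simp
  | cons p t ih =>
    rw [List.flatMap_cons, List.count_append, ih]
    simp [BX, NGb_count n p.1 .g rfl (by simp)]

lemma X_bits (n : ℕ) (L : List (Fin n × Fin n)) :
    (L.flatMap (BX n)).countP isBit = L.length * (2 * Nat.clog 2 n) := by
  induction L with
  | nil => simp
  | cons p t ih =>
    rw [List.flatMap_cons, List.countP_append, ih]
    simp [BX, NGb_bits n p.1, isBit]
    ring

lemma Y_hash (n : ℕ) (G : SimpleGraph (Fin n)) (L : List (Fin n × Fin n)) :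
    (L.flatMap (BY n G)).count .hash = L.length * 2 := by
  induction L with
  | nil => simp
  | cons p t ih =>
    rw [List.flatMap_cons, List.count_append, ih]
    simp [BY, LGb_hash]
    ring

lemma Y_dollar (n : ℕ) (G : SimpleGraph (Fin n)) (L : List (Fin n × Fin n)) :
    (L.flatMap (BY n G)).count .dollar = L.length * (2 * n) := by
  induction L with
  | nil => simp
  | cons p t ih =>
    rw [List.flatMap_cons, List.count_append, ih]
    simp [BY, LGb_dollar]
    ring

lemma wsum (n k : ℕ) (xy : PT) (Z : List RBase) :
    (Z.map (fun b => wt n k (RSig.mk b xy))).sum = Z.countP isBit +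
      Z.count .dollar * (10 * logn n) + Z.count .hash * l1 n k + Z.count .g * l2 n k := by
  induction Z with
  | nil => simp
  | cons b t ih =>
    rw [List.map_cons, List.sum_cons, ih]
    cases b <;> simp [wt, List.countP_cons, isBit] <;> ring

/-! ### The single-gadget argument -/

lemma lg_arg (n : ℕ) (v : Fin n) (hv : binb n v ≠ []) (m b : ℕ) : ∀ (us : List (Fin n)) (a : ℕ),
    (List.replicate a RBase.dollar ++ binb n v ++ List.replicate b RBase.dollar).Sublist
      (us.flatMap (fun u => RBase.dollar :: (binb n u ++ [RBase.dollar])) ++ List.replicate m RBase.dollar) →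
    (List.replicate a RBase.dollar ++ binb n v ++ List.replicate b RBase.dollar).count RBase.dollar =
      (us.flatMap (fun u => RBase.dollar :: (binb n u ++ [RBase.dollar])) ++
        List.replicate m RBase.dollar).count RBase.dollar → v ∈ us := by
  have hvd : RBase.dollar ∉ binb n v := binb_notMem n v _ rfl
  intro us
  induction us with
  | nil =>
    intro a h _
    exfalso
    obtain ⟨x, hx⟩ := List.exists_mem_of_ne_nil _ hv
    have h3 := h.subset (List.mem_append_left _ (List.mem_append_right _ hx))
    simp only [List.flatMap_nil, List.nil_append] at h3
    have := List.eq_of_mem_replicate h3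
    exact hvd (this ▸ hx)
  | cons u t ih =>
    intro a h hc
    set Rest := t.flatMap (fun u => RBase.dollar :: (binb n u ++ [RBase.dollar])) ++
      List.replicate m RBase.dollar with hR
    have e : (u :: t).flatMap (fun u => RBase.dollar :: (binb n u ++ [RBase.dollar])) ++
      List.replicate m RBase.dollar = [] ++ RBase.dollar :: (binb n u ++ RBase.dollar :: Rest) := by
      simp [hR]
    rw [e] at h hc
    obtain ⟨Z1, Z2, hZ, h1, h2⟩ := split_count _ _ _ _ h hc
    obtain rfl := List.sublist_nil.1 h1
    rw [hZ] at hc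
    obtain ⟨P, Z', rfl, h3, h4⟩ := split_count RBase.dollar _ _ _ h2 (by simpa using hc)
    have hPd : RBase.dollar ∉ P := fun hh => binb_notMem n u _ rfl (h3.subset hh)
    have c1 : P.count RBase.dollar = 0 := List.count_eq_zero.2 hPd
    have c2 : (binb n u).count RBase.dollar = 0 := binb_count n u _ rfl
    simp [c1, c2] at hc
    cases a with
    | zero =>
      exfalso
      cases hb : binb n v with
      | nil => exact hv hb
      | cons x xs =>
        rw [hb] at hZ hvd
        simp at hZ hvd
        exact hvd.1 hZ.1.symm
    | succ a =>
      simp only [List.replicate_succ, List.cons_append, List.nil_append, List.cons.injEq,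
        true_and] at hZ
      cases a with
      | zero =>
        simp only [List.replicate_zero, List.nil_append] at hZ
        cases b with
        | zero =>
          exfalso
          simp only [List.replicate_zero, List.append_nil] at hZ
          exact hvd (by rw [hZ]; simp)
        | succ b =>
          rw [List.replicate_succ] at hZ
          obtain ⟨e1, -⟩ := split_unique _ _ _ _ _ hZ hvd hPd
          subst e1
          have := h3.eq_of_length (by simp [binb_length])
          rw [binb_inj n v u this]
          exact List.mem_cons_self
      | succ a =>
        cases P with
        | cons x xs =>
          exfalso
          simp only [List.replicate_succ, List.cons_append, List.cons.injEq] at hZ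
          exact hPd (by rw [← hZ.1]; simp)
        | nil =>
          simp only [List.replicate_succ, List.cons_append, List.nil_append, List.cons.injEq,
            true_and] at hZ
          refine List.mem_cons_of_mem _ (ih a ?_ ?_)
          · rw [hZ]; exact h4
          · rw [hZ]; exact hc

lemma gadget_arg (n : ℕ) (hn : 2 ≤ n) (G : SimpleGraph (Fin n)) (v u : Fin n) (Z : List RBase)
    (h1 : Z.Sublist (NGb n v)) (h2 : Z.Sublist (LGb n G u))
    (hb : Z.countP isBit = 2 * Nat.clog 2 n) (hd : Z.count RBase.dollar = 2 * n) : G.Adj u v := by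
  have hv : binb n v ≠ [] := by
    intro h
    have h3 := binb_length n v
    have h4 : 0 < Nat.clog 2 n := Nat.clog_pos one_lt_two hn
    rw [h] at h3
    simp at h3
    omega
  unfold NGb at h1
  obtain ⟨Z1, Zc, rfl, h3, h4⟩ := List.sublist_append_iff.1 h1
  obtain ⟨Za, Zb, rfl, h5, h6⟩ := List.sublist_append_iff.1 h3
  obtain ⟨a, -, rfl⟩ := List.sublist_replicate_iff.1 h5
  obtain ⟨b, -, rfl⟩ := List.sublist_replicate_iff.1 h4
  have e : Zb = binb n v := by
    apply h6.eq_of_length_le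
    rw [binb_length, ← hb]
    simp only [List.countP_append, List.countP_replicate]
    simpa [isBit] using List.countP_le_length
  subst e
  have := lg_arg n v hv (2 * (nonNbrs n G u).length) b (nbrs n G u) a h2 (hd.trans (LGb_dollar n G u).symm)
  simpa [nbrs] using this

lemma main_arg (n : ℕ) (hn : 2 ≤ n) (G : SimpleGraph (Fin n)) : ∀ (L : List (Fin n × Fin n))
    (Z : List RBase), Z.Sublist (L.flatMap (BX n)) → Z.Sublist (L.flatMap (BY n G)) →
    Z.countP isBit = L.length * (2 * Nat.clog 2 n) → Z.count RBase.dollar = L.length * (2 * n) →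
    Z.count .hash = L.length * 2 → ∀ p ∈ L, G.Adj p.2 p.1 := by
  intro L
  induction L with
  | nil => intro _ _ _ _ _ _ p hp; simp at hp
  | cons q t ih =>
    intro Z hX hY hb hd hh
    have sp : ∀ (A R : List RBase), Z.Sublist ((RBase.hash :: (A ++ [.hash])) ++ R) →
        A.count .hash = 0 → R.count .hash = t.length * 2 →
        ∃ P Z', Z = .hash :: (P ++ .hash :: Z') ∧ P.Sublist A ∧ Z'.Sublist R ∧
          RBase.hash ∉ P := by
      intro A R h hA hR
      have e : (RBase.hash :: (A ++ [.hash])) ++ R = [] ++ .hash :: (A ++ .hash :: R) := by simp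
      rw [e] at h
      obtain ⟨Z1, Z2, hZ, h1, h2⟩ := split_count _ _ _ _ h (by
        rw [hh]; simp [hA, hR]; ring)
      obtain rfl := List.sublist_nil.1 h1
      have hZ2 : Z2.count .hash = t.length * 2 + 1 := by
        rw [hZ] at hh; simp at hh; omega
      obtain ⟨P, Z', rfl, h3, h4⟩ := split_count RBase.hash _ _ _ h2 (by
        rw [hZ2]; simp [hA, hR])
      exact ⟨P, Z', hZ, h3, h4, fun hm => List.count_eq_zero.1 hA (h3.subset hm)⟩
    rw [List.flatMap_cons] at hX hY
    obtain ⟨P, Z', e1, hP1, hZ1, hPn⟩ := sp _ _ hX (NGb_count n q.1 .hash rfl (by simp))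
      (X_hash n t)
    obtain ⟨P', Z'', e2, hP2, hZ2, hPn'⟩ := sp _ _ hY (LGb_hash n G q.2) (Y_hash n G t)
    have e3 := e1.symm.trans e2
    simp only [List.cons.injEq, true_and] at e3
    obtain ⟨rfl, rfl⟩ := split_unique _ _ _ _ _ e3 hPn hPn'
    have b1 := hP1.countP_le (p := isBit)
    have b2 := hZ1.countP_le (p := isBit)
    have d1 := hP2.count_le RBase.dollar
    have d2 := hZ2.count_le RBase.dollar
    rw [NGb_bits] at b1
    rw [X_bits] at b2
    rw [LGb_dollar] at d1
    rw [Y_dollar] at d2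
    have hP0 : P.count .hash = 0 := List.count_eq_zero.2 hPn
    rw [e1] at hb hd hh
    simp [isBit] at hb
    simp at hd
    simp [hP0] at hh
    rw [add_mul, one_mul] at hb hd
    intro p hp
    rcases List.mem_cons.1 hp with rfl | hp
    · exact gadget_arg n hn G p.1 p.2 P hP1 hP2 (by omega) (by omega)
    · exact ih Z' hZ1 hZ2 (by omega) (by omega) (by omega) p hp

/-! ### The construction -/

lemma lg_con (n : ℕ) (v : Fin n) : ∀ (us : List (Fin n)), v ∈ us →
    ∃ a b, a + b = 2 * us.length ∧
      (List.replicate a RBase.dollar ++ binb n v ++ List.replicate b RBase.dollar).Sublist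
      (us.flatMap (fun u => RBase.dollar :: (binb n u ++ [RBase.dollar]))) := by
  have all : ∀ us : List (Fin n), (List.replicate (2 * us.length) RBase.dollar).Sublist
      (us.flatMap (fun u => RBase.dollar :: (binb n u ++ [RBase.dollar]))) := by
    intro us
    rw [List.replicate_sublist_iff, count_nb n us _ rfl]
    simp
  intro us
  induction us with
  | nil => intro h; simp at h
  | cons u t ih =>
    intro h
    rw [List.flatMap_cons]
    by_cases hu : v = u
    · subst hu
      refine ⟨1, 1 + 2 * t.length, by simp; ring, ?_⟩
      rw [List.replicate_add, ← List.append_assoc]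
      refine List.Sublist.append ?_ (all t)
      simp
    · obtain ⟨a, b, hab, hs⟩ := ih (by simpa [hu] using h)
      refine ⟨2 + a, b, by simp; omega, ?_⟩
      rw [List.replicate_add, List.append_assoc, List.append_assoc]
      refine List.Sublist.append ?_ (by simpa using hs)
      simpa using all [u]

lemma gadget_con (n : ℕ) (G : SimpleGraph (Fin n)) (v u : Fin n) (h : G.Adj u v) :
    ∃ Z : List RBase, Z.Sublist (NGb n v) ∧ Z.Sublist (LGb n G u) ∧
      Z.countP isBit = 2 * Nat.clog 2 n ∧ Z.count RBase.dollar = 2 * n := by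
  obtain ⟨a, b, hab, hs⟩ := lg_con n v (nbrs n G u) (by simpa [nbrs] using h)
  have hl := nbrs_length n G u
  refine ⟨List.replicate a RBase.dollar ++ binb n v ++
    List.replicate (b + 2 * (nonNbrs n G u).length) RBase.dollar, ?_, ?_, ?_, ?_⟩
  · unfold NGb
    refine List.Sublist.append (List.Sublist.append ?_ (List.Sublist.refl _)) ?_
    · exact (List.replicate_sublist_replicate _).2 (by omega)
    · exact (List.replicate_sublist_replicate _).2 (by omega)
  · unfold LGb
    rw [List.replicate_add, ← List.append_assoc]
    exact List.Sublist.append hs (List.Sublist.refl _)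
  · simp only [List.countP_append, List.countP_replicate, binb_countP]
    simp [isBit]
  · simp only [List.count_append, List.count_replicate, binb_count n v RBase.dollar rfl]
    simp
    omega

lemma main_con (n : ℕ) (G : SimpleGraph (Fin n)) : ∀ (L : List (Fin n × Fin n)),
    (∀ p ∈ L, G.Adj p.2 p.1) → ∃ Z : List RBase,
      Z.Sublist (L.flatMap (BX n)) ∧ Z.Sublist (L.flatMap (BY n G)) ∧
      Z.countP isBit = L.length * (2 * Nat.clog 2 n) ∧ Z.count RBase.dollar = L.length * (2 * n) ∧
      Z.count .hash = L.length * 2 := by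
  intro L
  induction L with
  | nil => intro _; exact ⟨[], by simp⟩
  | cons q t ih =>
    intro h
    obtain ⟨Z', h1, h2, h3, h4, h5⟩ := ih (fun p hp => h p (List.mem_cons_of_mem _ hp))
    obtain ⟨P, g1, g2, g3, g4⟩ := gadget_con n G q.1 q.2 (h q List.mem_cons_self)
    have g5 : P.count .hash = 0 := by
      have := g1.count_le .hash
      rw [NGb_count n q.1 .hash rfl (by simp)] at this
      omega
    have sub : ∀ A : List RBase, P.Sublist A →
        (RBase.hash :: (P ++ [.hash])).Sublist (.hash :: (A ++ [.hash])) := fun A hA =>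
      (hA.append (List.Sublist.refl _)).cons_cons _
    refine ⟨(.hash :: (P ++ [.hash])) ++ Z', ?_, ?_, ?_, ?_, ?_⟩
    · rw [List.flatMap_cons]; exact (sub _ g1).append h1
    · rw [List.flatMap_cons]; exact (sub _ g2).append h2
    · simp [isBit, g3, h3]; ring
    · simp [g4, h4]; ring
    · simp [g5, h5]; ring

lemma clique_iff (n k : ℕ) (G : SimpleGraph (Fin n)) (t₁ t₂ : Finset (Fin n))
    (h1 : G.IsNClique k t₁) (h2 : G.IsNClique k t₂) :
    G.IsNClique (2 * k) (t₁ ∪ t₂) ↔ ∀ p ∈ prs t₁ t₂, G.Adj p.2 p.1 := by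
  constructor
  · intro h p hp
    rw [mem_prs] at hp
    have hdis : Disjoint t₁ t₂ := by
      rw [← Finset.card_union_eq_card_add_card, h.card_eq, h1.card_eq, h2.card_eq]; ring
    refine h.isClique (by simp [hp.2]) (by simp [hp.1]) ?_
    intro e
    exact Finset.disjoint_left.1 hdis hp.1 (e ▸ hp.2)
  · intro h
    have h' : ∀ v ∈ t₁, ∀ u ∈ t₂, G.Adj u v := fun v hv u hu =>
      h (v, u) ((mem_prs t₁ t₂ _).2 ⟨hv, hu⟩)
    have hdis : Disjoint t₁ t₂ := by
      rw [Finset.disjoint_left]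
      intro a ha hb
      exact G.irrefl (h' a ha a hb)
    refine ⟨?_, ?_⟩
    · intro a ha b hb hab
      simp only [Finset.coe_union, Set.mem_union, Finset.mem_coe] at ha hb
      rcases ha with ha | ha <;> rcases hb with hb | hb
      · exact h1.isClique ha hb hab
      · exact (h' a ha b hb).symm
      · exact h' b hb a ha
      · exact h2.isClique ha hb hab
    · rw [Finset.card_union_of_disjoint hdis, h1.card_eq, h2.card_eq]; ring

/-- Claim 3.5 of the paper.
There is an integer `E₂` depending only on `n` and `k` (the paper computes
`E₂ = 2k²·ℓ₁ + k²·E₁`) such that for every `xy ∈ {αβ, αγ, βγ}` and every pair of `k`-cliques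
`t₁, t₂ ∈ C_k`: the weighted RNA folding score `WRNA([CNG(t₁) ∘ p(CLG(t₂))^R]_xy)` equals `E₂`
if `t₁ ∪ t₂` forms a `2k`-clique in `G`, and is at most `E₂ − 1` otherwise. -/
theorem wrna_clique_gadget_pair (n k : ℕ) :
    ∃ E₂ : ℕ, ∀ (G : SimpleGraph (Fin n)) (xy : PT) (t₁ t₂ : Finset (Fin n)),
      G.IsNClique k t₁ → G.IsNClique k t₂ →
      (G.IsNClique (2 * k) (t₁ ∪ t₂) →
        WRNA (wt n k) (markStr xy (CNGr n k t₁ ++ (primeStr (CLGr n k G t₂)).reverse)) = E₂) ∧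
      (¬ G.IsNClique (2 * k) (t₁ ∪ t₂) →
        WRNA (wt n k) (markStr xy (CNGr n k t₁ ++ (primeStr (CLGr n k G t₂)).reverse))
          ≤ E₂ - 1) := by
  refine ⟨k * k * (2 * Nat.clog 2 n) + k * k * (2 * n) * (10 * logn n) + k * k * 2 * l1 n k, ?_⟩
  intro G xy t₁ t₂ h1 h2
  rw [clique_iff n k G t₁ t₂ h1 h2, str_eq n k G xy t₁ t₂ h1.card_eq h2.card_eq]
  have hlen : (prs t₁ t₂).length = k * k := by rw [prs_length, h1.card_eq, h2.card_eq]
  set L := prs t₁ t₂ with hL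
  have hφ : Function.Injective (fun b => RSig.mk b xy) := by
    intro a b h
    simpa using h
  set S := {m | ∃ A : Finset (ℕ × ℕ), IsFolding (dbl (fun b => RSig.mk b xy)
      (L.flatMap (BX n)) (L.flatMap (BY n G))) A ∧
    ∑ p ∈ A, ((dbl (fun b => RSig.mk b xy) (L.flatMap (BX n)) (L.flatMap (BY n G))).map
      (Sum.elim (wt n k) (wt n k))).getD p.1 0 = m} with hS
  have hW : WRNA (wt n k) (dbl (fun b => RSig.mk b xy)
      (L.flatMap (BX n)) (L.flatMap (BY n G))) = sSup S := rfl
  rw [hW]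
  have hmem : ∀ m ∈ S, ∃ Z : List RBase, Z.Sublist (L.flatMap (BX n)) ∧
      Z.Sublist (L.flatMap (BY n G)) ∧ Z.countP isBit ≤ k * k * (2 * Nat.clog 2 n) ∧
      Z.count .dollar ≤ k * k * (2 * n) ∧ Z.count .hash ≤ k * k * 2 ∧
      m = Z.countP isBit + Z.count .dollar * (10 * logn n) + Z.count .hash * l1 n k := by
    rintro m ⟨A, hA, rfl⟩
    obtain ⟨Z, hX, hY, hs⟩ := fold_to_sub _ hφ (wt n k) _ _ A hA
    have b1 := hX.countP_le (p := isBit)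
    have b2 := hY.count_le .dollar
    have b3 := hX.count_le .hash
    have b4 := hX.count_le .g
    rw [X_bits, hlen] at b1
    rw [Y_dollar, hlen] at b2
    rw [X_hash, hlen] at b3
    rw [X_g] at b4
    refine ⟨Z, hX, hY, b1, b2, b3, ?_⟩
    rw [← hs, wsum, Nat.le_zero.1 b4]
    simp
  have hub : ∀ m ∈ S, m ≤ k * k * (2 * Nat.clog 2 n) + k * k * (2 * n) * (10 * logn n) +
      k * k * 2 * l1 n k := by
    intro m hm
    obtain ⟨Z, -, -, b1, b2, b3, rfl⟩ := hmem m hm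
    gcongr
  have hbdd : BddAbove S := ⟨_, hub⟩
  have hne : S.Nonempty := ⟨0, ∅, ⟨by simp, by simp⟩, by simp⟩
  constructor
  · intro h
    refine le_antisymm (csSup_le hne hub) (le_csSup hbdd ?_)
    obtain ⟨Z, hX, hY, c1, c2, c3⟩ := main_con n G L h
    obtain ⟨A, hA, hs⟩ := sub_to_fold (fun b => RSig.mk b xy) (wt n k) _ _ Z hX hY
    refine ⟨A, hA, hs.trans ?_⟩
    have b4 := hX.count_le .g
    rw [X_g] at b4
    rw [wsum, c1, c2, c3, hlen, Nat.le_zero.1 b4]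
    simp
  · intro h
    have hm := Nat.sSup_mem hne hbdd
    have hle := hub _ hm
    by_contra hcon
    obtain ⟨Z, hX, hY, b1, b2, b3, hZ⟩ := hmem _ hm
    have hk : 0 < k := by
      rcases Nat.eq_zero_or_pos k with h0 | h0
      · exfalso
        subst h0
        simp at hle hcon
        omega
      · exact h0
    have hn : 2 ≤ n := by
      by_contra hn
      have e1 : Nat.clog 2 n = 0 := Nat.clog_of_right_le_one (by omega) 2
      have e2 : logn n = 0 := Nat.log_of_lt (by omega)
      simp [e1, e2, l1] at hle hcon
      omega
    have hlog : 0 < logn n := Nat.log_pos one_lt_two hn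
    have hl1 : 0 < l1 n k := by unfold l1; positivity
    have m2 : Z.count .dollar * (10 * logn n) ≤ k * k * (2 * n) * (10 * logn n) :=
      Nat.mul_le_mul_right _ b2
    have m3 : Z.count .hash * l1 n k ≤ k * k * 2 * l1 n k := Nat.mul_le_mul_right _ b3
    rw [hZ] at hle hcon
    have q1 : Z.countP isBit = k * k * (2 * Nat.clog 2 n) := by omega
    have q2 : Z.count .dollar * (10 * logn n) = k * k * (2 * n) * (10 * logn n) := by omega
    have q3 : Z.count .hash * l1 n k = k * k * 2 * l1 n k := by omega
    have r2 := Nat.eq_of_mul_eq_mul_right (by omega) q2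
    have r3 := Nat.eq_of_mul_eq_mul_right hl1 q3
    exact h (main_arg n hn G L Z hX hY (by rw [hlen]; exact q1) (by rw [hlen]; exact r2)
      (by rw [hlen]; exact r3))

end RNAFolding
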